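/- Let 3/5 < α < 1. Then there exists R > 0 such that E_{α,1}(i t) ≠ 0 for all real t with |t| ≥ R. Consequently, the set {t ∈ ℝ : E_{α,1}(i t) = 0} is finite. -/

import Mathlib

open Complex Real

/-- The Mittag-Leffler function `E_{α,β}(z) = ∑ zⁿ / Γ(αn+β)`. -/
noncomputable def mlE (α β : ℝ) (z : ℂ) : ℂ :=
  ∑' n : ℕ, z ^ n / Complex.Gamma ((α * n + β : ℝ) : ℂ)

open MeasureTheory Filter Topology Set

lemma ml_gamma_lower (x M : ℝ) (hx : 0 ≤ x) (hM : 0 ≤ M) :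
    M ^ x * Real.exp (-M) ≤ Real.Gamma (x + 1) := by
  have hint := Real.GammaIntegral_convergent (s := x + 1) (by linarith)
  rw [Real.Gamma_eq_integral (by linarith)]
  have h1 : ∫ t in Ioi M, Real.exp (-t) * M ^ x = M ^ x * Real.exp (-M) := by
    rw [integral_mul_const, integral_exp_neg_Ioi, mul_comm]
  rw [← h1]
  have hs : Ioi M ⊆ Ioi (0:ℝ) := Ioi_subset_Ioi hM
  calc ∫ t in Ioi M, Real.exp (-t) * M ^ x
      ≤ ∫ t in Ioi M, Real.exp (-t) * t ^ (x + 1 - 1) := by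
        apply setIntegral_mono_on _ (hint.mono_set hs) measurableSet_Ioi
        · intro t ht
          have ht : M < t := ht
          rw [add_sub_cancel_right]
          gcongr
        · exact (integrableOn_exp_neg_Ioi M).mul_const _
    _ ≤ _ := by
        apply setIntegral_mono_set hint _ hs.eventuallyLE
        filter_upwards [ae_restrict_mem measurableSet_Ioi] with t ht
        have ht : 0 < t := ht
        simp only [Pi.zero_apply]; positivity

lemma ml_gamma_pos (α : ℝ) (h0 : 0 < α) (n : ℕ) : 0 < Real.Gamma (α * n + 1) :=
  Real.Gamma_pos_of_pos (by positivity)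

lemma ml_summable (α : ℝ) (h0 : 0 < α) (r : ℝ) (hr : 0 ≤ r) :
    Summable (fun n : ℕ => r ^ n / Real.Gamma (α * n + 1)) := by
  set M : ℝ := (2 * r + 1) ^ (1 / α) with hMdef
  have hM : 0 < M := by positivity
  have hMa : M ^ α = 2 * r + 1 := by
    rw [hMdef, ← Real.rpow_mul (by positivity)]
    simp [h0.ne']
  have hq : r / (2 * r + 1) < 1 := by rw [div_lt_one (by positivity)]; linarith
  refine Summable.of_nonneg_of_le (fun n => ?_) (fun n => ?_)
    ((summable_geometric_of_lt_one (by positivity) hq).mul_left (Real.exp M))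
  · have := ml_gamma_pos α h0 n
    positivity
  · have h := ml_gamma_lower (α * n) M (by positivity) hM.le
    rw [Real.rpow_mul hM.le, hMa, Real.rpow_natCast] at h
    have := ml_gamma_pos α h0 n
    rw [div_le_iff₀ this]
    calc r ^ n = Real.exp M * (r / (2 * r + 1)) ^ n * ((2 * r + 1) ^ n * Real.exp (-M)) := by
          rw [div_pow, Real.exp_neg]; field_simp
      _ ≤ _ := by gcongr

lemma ml_term_norm (α : ℝ) (h0 : 0 < α) (z : ℂ) (n : ℕ) :
    ‖z ^ n / Complex.Gamma ((α * n + 1 : ℝ) : ℂ)‖ = ‖z‖ ^ n / Real.Gamma (α * n + 1) := by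
  rw [Complex.Gamma_ofReal, norm_div, norm_pow, Complex.norm_real, Real.norm_eq_abs,
    abs_of_pos (ml_gamma_pos α h0 n)]

lemma ml_hasSum (α : ℝ) (h0 : 0 < α) (z : ℂ) :
    HasSum (fun n : ℕ => z ^ n / Complex.Gamma ((α * n + 1 : ℝ) : ℂ)) (mlE α 1 z) := by
  apply Summable.hasSum
  apply Summable.of_norm
  simp_rw [ml_term_norm α h0]
  exact ml_summable α h0 _ (norm_nonneg _)

lemma ml_differentiable (α : ℝ) (h0 : 0 < α) : Differentiable ℂ (mlE α 1) := by
  intro z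
  have : DifferentiableOn ℂ (mlE α 1) (Metric.ball 0 (‖z‖ + 1)) := by
    apply Complex.differentiableOn_tsum_of_summable_norm
      (ml_summable α h0 (‖z‖ + 1) (by positivity)) _ Metric.isOpen_ball
    · intro n w hw
      rw [ml_term_norm α h0]
      have := ml_gamma_pos α h0 n
      have : ‖w‖ < ‖z‖ + 1 := by simpa using hw
      gcongr
    · intro n
      fun_prop
  exact this.differentiableAt (Metric.isOpen_ball.mem_nhds (by simp))

lemma ml_zero (α : ℝ) : mlE α 1 0 = 1 := by
  unfold mlE
  rw [tsum_eq_single 0]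
  · simp
  · intro n hn; simp [hn]

lemma ml_conj (α : ℝ) (z : ℂ) : mlE α 1 (starRingEnd ℂ z) = starRingEnd ℂ (mlE α 1 z) := by
  unfold mlE
  rw [Complex.conj_tsum]
  congr 1; ext n
  rw [Complex.Gamma_ofReal]
  simp

lemma ml_finite (α : ℝ) (h0 : 0 < α) (R : ℝ)
    (hR : ∀ t : ℝ, R ≤ |t| → mlE α 1 (Complex.I * t) ≠ 0) :
    {t : ℝ | mlE α 1 (Complex.I * t) = 0}.Finite := by
  by_contra hinf
  have hinf : {t : ℝ | mlE α 1 (Complex.I * t) = 0}.Infinite := hinf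
  obtain ⟨x, -, hx⟩ := hinf.exists_accPt_of_subset_isCompact (isCompact_Icc (a := -R) (b := R)) (by
    intro t ht
    by_contra hc
    apply hR t _ ht
    by_contra hlt
    push Not at hlt
    exact hc (abs_le.1 hlt.le))
  rw [accPt_iff_frequently] at hx
  have hd : Differentiable ℂ (fun w : ℂ => mlE α 1 (Complex.I * w)) :=
    (ml_differentiable α h0).comp (by fun_prop)
  have han : AnalyticOnNhd ℂ (fun w : ℂ => mlE α 1 (Complex.I * w)) univ :=
    fun w _ => hd.analyticAt w
  have := han.eqOn_zero_of_preconnected_of_frequently_eq_zero isPreconnected_univ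
    (mem_univ (x : ℂ)) (by
      rw [frequently_nhdsWithin_iff]
      have hc : Tendsto (fun y : ℝ => (y : ℂ)) (𝓝 x) (𝓝 (x : ℂ)) :=
        Complex.continuous_ofReal.tendsto x
      refine hc.frequently (hx.mono ?_)
      rintro y ⟨hy, hy2⟩
      exact ⟨hy2, by simpa using hy⟩)
  have h2 := this (mem_univ 0)
  simp [ml_zero] at h2

/-- The auxiliary function `τ^(1-α)/Γ(1-α) + i τ E(i τ^α)`. -/
noncomputable def mlg (α τ : ℝ) : ℂ :=
  ((τ ^ (1 - α) / Real.Gamma (1 - α) : ℝ) : ℂ) +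
    Complex.I * τ * mlE α 1 (Complex.I * ((τ ^ α : ℝ) : ℂ))

/-- Absolute value of the terms of the series for `mlg`. -/
noncomputable def mlh (α : ℝ) (m : ℕ) (τ : ℝ) : ℝ :=
  τ ^ (α * m + (1 - α)) / Real.Gamma (α * m + (1 - α))

lemma mlh_succ (α : ℝ) (n : ℕ) (τ : ℝ) (hτ : 0 < τ) :
    mlh α (n + 1) τ = τ * ((τ ^ α) ^ n / Real.Gamma (α * n + 1)) := by
  unfold mlh
  have : α * ((n + 1 : ℕ) : ℝ) + (1 - α) = α * n + 1 := by push_cast; ring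
  rw [this, Real.rpow_add hτ, Real.rpow_mul hτ.le, Real.rpow_natCast, Real.rpow_one]
  ring

lemma mlh_arg_pos (α : ℝ) (h0 : 0 < α) (h1 : α < 1) (m : ℕ) : 0 < α * m + (1 - α) := by
  have : 0 ≤ α * m := by positivity
  linarith

lemma mlh_pos (α : ℝ) (h0 : 0 < α) (h1 : α < 1) (m : ℕ) (τ : ℝ) (hτ : 0 < τ) :
    0 < mlh α m τ := by
  unfold mlh
  have := Real.Gamma_pos_of_pos (mlh_arg_pos α h0 h1 m)
  positivity

lemma mlh_summable (α : ℝ) (h0 : 0 < α) (τ : ℝ) (hτ : 0 < τ) :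
    Summable (fun m => mlh α m τ) := by
  rw [← summable_nat_add_iff 1]
  simp_rw [mlh_succ α _ τ hτ]
  exact (ml_summable α h0 _ (by positivity)).mul_left _

lemma mlg_hasSum (α : ℝ) (h0 : 0 < α) (τ : ℝ) (hτ : 0 < τ) :
    HasSum (fun m => Complex.I ^ m * (mlh α m τ : ℂ)) (mlg α τ) := by
  rw [← hasSum_nat_add_iff' 1]
  have h := (ml_hasSum α h0 (Complex.I * ((τ ^ α : ℝ) : ℂ))).mul_left (Complex.I * τ)
  convert! h using 1
  · ext n
    rw [mlh_succ α n τ hτ, Complex.Gamma_ofReal]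
    push_cast
    rw [mul_pow, pow_succ]
    ring
  · simp [mlg, mlh]

lemma mlg_continuousOn (α : ℝ) (h0 : 0 < α) : ContinuousOn (mlg α) (Ioi 0) := by
  unfold mlg
  have hE := (ml_differentiable α h0).continuous
  have h1 : ∀ b : ℝ, ContinuousOn (fun τ : ℝ => τ ^ b) (Ioi 0) := fun b =>
    ContinuousOn.rpow_const continuousOn_id (fun x hx => Or.inl (ne_of_gt hx))
  refine ContinuousOn.add ?_ (ContinuousOn.mul ?_ ?_)
  · exact Complex.continuous_ofReal.comp_continuousOn ((h1 _).div_const _)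
  · fun_prop
  · exact hE.comp_continuousOn (continuousOn_const.mul
      (Complex.continuous_ofReal.comp_continuousOn (h1 _)))

lemma mlh_laplace (α : ℝ) (h0 : 0 < α) (h1 : α < 1) (m : ℕ) (c : ℝ) (hc : 0 < c) :
    ∫ τ in Ioi (0:ℝ), mlh α m τ * Real.exp (-(c * τ)) =
      (α * m + (1 - α)) * ((1 / c) ^ (2 - α) * ((1 / c) ^ α) ^ m) := by
  have hp := mlh_arg_pos α h0 h1 m
  have h := Real.integral_rpow_mul_exp_neg_mul_Ioi (a := α * m + (1 - α) + 1) (r := c)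
    (by linarith) hc
  rw [add_sub_cancel_right, Real.Gamma_add_one hp.ne'] at h
  have hG := Real.Gamma_pos_of_pos hp
  have hc' : 0 < 1 / c := by positivity
  have : ∀ τ, mlh α m τ * Real.exp (-(c * τ)) = (Real.Gamma (α * m + (1 - α)))⁻¹ *
      (τ ^ (α * m + (1 - α)) * Real.exp (-(c * τ))) := by
    intro τ; unfold mlh; ring
  simp_rw [this]
  rw [integral_const_mul, h, show α * m + (1 - α) + 1 = (2 - α) + α * m by ring,
    Real.rpow_add hc', Real.rpow_mul hc'.le, Real.rpow_natCast]
  field_simp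

lemma mlh_integrable (α : ℝ) (h0 : 0 < α) (h1 : α < 1) (m : ℕ) (c : ℝ) (hc : 0 < c) :
    IntegrableOn (fun τ => mlh α m τ * Real.exp (-(c * τ))) (Ioi 0) := by
  have h := mlh_laplace α h0 h1 m c hc
  have hp := mlh_arg_pos α h0 h1 m
  by_contra hn
  rw [integral_undef hn] at h
  have : 0 < (α * m + (1 - α)) * ((1 / c) ^ (2 - α) * ((1 / c) ^ α) ^ m) := by positivity
  linarith

lemma ml_geom {𝕜 : Type*} [NormedField 𝕜] [CompleteSpace 𝕜] (a b d q : 𝕜) (hq : ‖q‖ < 1) :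
    HasSum (fun m : ℕ => (a * m + b) * (d * q ^ m))
      (d * (a * (q / (1 - q) ^ 2) + b * (1 - q)⁻¹)) := by
  have := (((hasSum_coe_mul_geometric_of_norm_lt_one hq).mul_left a).add
    ((hasSum_geometric_of_norm_lt_one hq).mul_left b)).mul_left d
  convert! this using 1
  ext m; ring

lemma ml_qlt (α : ℝ) (h0 : 0 < α) (c : ℝ) (hc : 1 < c) : (1 / c) ^ α < 1 := by
  apply Real.rpow_lt_one (by positivity) _ h0
  rw [div_lt_one (by linarith)]; exact hc

lemma mlh_laplace_summable (α : ℝ) (h0 : 0 < α) (c : ℝ) (hc : 1 < c) :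
    Summable (fun m : ℕ => (α * m + (1 - α)) * ((1 / c) ^ (2 - α) * ((1 / c) ^ α) ^ m)) := by
  refine (ml_geom α (1 - α) _ _ ?_).summable
  rw [Real.norm_of_nonneg (by positivity)]
  exact ml_qlt α h0 c hc

lemma mlS_integrable (α : ℝ) (h0 : 0 < α) (h1 : α < 1) (c : ℝ) (hc : 1 < c) :
    IntegrableOn (fun τ => ∑' m, mlh α m τ * Real.exp (-(c * τ))) (Ioi 0) := by
  have hc0 : 0 < c := by linarith
  have hs : HasSum _ _ := hasSum_integral_of_summable_integral_norm (μ := volume.restrict (Ioi 0))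
    (F := fun m τ => mlh α m τ * Real.exp (-(c * τ)))
    (fun m => mlh_integrable α h0 h1 m c hc0) (by
      have := mlh_laplace_summable α h0 c hc
      refine this.congr (fun m => ?_)
      rw [← mlh_laplace α h0 h1 m c hc0]
      refine setIntegral_congr_fun measurableSet_Ioi (fun τ hτ => ?_)
      have := mlh_pos α h0 h1 m τ hτ
      rw [Real.norm_of_nonneg (by positivity)])
  simp_rw [mlh_laplace α h0 h1 _ c hc0] at hs
  by_contra hn
  rw [integral_undef hn] at hs
  have hp := mlh_arg_pos α h0 h1
  have h2 := (hasSum_zero_iff_of_nonneg (fun m => by have := hp m; positivity)).1 hs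
  have h3 := congrFun h2 0
  have : 0 < (α * (0:ℕ) + (1 - α)) * ((1 / c) ^ (2 - α) * ((1 / c) ^ α) ^ 0) := by
    have := hp 0
    positivity
  simp only [Pi.zero_apply] at h3
  linarith

lemma mlg_integrable (α : ℝ) (h0 : 0 < α) (h1 : α < 1) (c : ℝ) (hc : 1 < c) :
    IntegrableOn (fun τ => mlg α τ * (Real.exp (-(c * τ)) : ℂ)) (Ioi 0) := by
  refine Integrable.mono' (mlS_integrable α h0 h1 c hc) ?_ ?_
  · refine ContinuousOn.aestronglyMeasurable ?_ measurableSet_Ioi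
    exact (mlg_continuousOn α h0).mul (by fun_prop)
  · filter_upwards [ae_restrict_mem measurableSet_Ioi] with τ hτ
    have hτ : 0 < τ := hτ
    rw [tsum_mul_right, norm_mul, Complex.norm_real, Real.norm_of_nonneg (Real.exp_pos _).le]
    gcongr
    rw [← (mlg_hasSum α h0 τ hτ).tsum_eq]
    have hnorm : ∀ m, ‖Complex.I ^ m * (mlh α m τ : ℂ)‖ = mlh α m τ := by
      intro m
      rw [norm_mul, norm_pow, Complex.norm_I, one_pow, one_mul, Complex.norm_real,
        Real.norm_of_nonneg (mlh_pos α h0 h1 m τ hτ).le]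
    refine (norm_tsum_le_tsum_norm ?_).trans ?_
    · simp_rw [hnorm]; exact mlh_summable α h0 τ hτ
    · simp_rw [hnorm]; exact le_rfl

lemma mlg_laplace_real (α : ℝ) (h0 : 0 < α) (h1 : α < 1) (c : ℝ) (hc : 1 < c) :
    HasSum (fun m : ℕ => ((α : ℂ) * m + (1 - α)) * (((1 / c) ^ (2 - α) : ℝ) *
      (Complex.I * ((1 / c) ^ α : ℝ)) ^ m))
      (∫ τ in Ioi (0:ℝ), mlg α τ * (Real.exp (-(c * τ)) : ℂ)) := by
  have hc0 : 0 < c := by linarith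
  have hs : HasSum _ _ := hasSum_integral_of_summable_integral_norm (μ := volume.restrict (Ioi 0))
    (F := fun m τ => Complex.I ^ m * ((mlh α m τ * Real.exp (-(c * τ)) : ℝ) : ℂ))
    (fun m => (mlh_integrable α h0 h1 m c hc0).ofReal.const_mul _) (by
      have := mlh_laplace_summable α h0 c hc
      refine this.congr (fun m => ?_)
      rw [← mlh_laplace α h0 h1 m c hc0]
      refine setIntegral_congr_fun measurableSet_Ioi (fun τ hτ => ?_)
      have := mlh_pos α h0 h1 m τ hτ
      rw [norm_mul, norm_pow, Complex.norm_I, one_pow, one_mul, Complex.norm_real,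
        Real.norm_of_nonneg (by positivity)])
  convert! hs using 1
  · ext m
    rw [integral_const_mul, integral_complex_ofReal, mlh_laplace α h0 h1 m c hc0]
    push_cast
    rw [mul_pow]
    ring
  · refine setIntegral_congr_fun measurableSet_Ioi (fun τ hτ => ?_)
    rw [← (mlg_hasSum α h0 τ hτ).tsum_eq, ← tsum_mul_right]
    congr 1; ext m
    push_cast; ring

/-- The Laplace transform of `mlg`. -/
noncomputable def mlG (α : ℝ) (s : ℂ) : ℂ :=
  s ^ ((2 * α - 2 : ℝ) : ℂ) * ((1 - α) / (s ^ (α : ℂ) - Complex.I) +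
    α * Complex.I / (s ^ (α : ℂ) - Complex.I) ^ 2)

lemma mlG_real (α : ℝ) (h0 : 0 < α) (h1 : α < 1) (c : ℝ) (hc : 1 < c) :
    ∫ τ in Ioi (0:ℝ), mlg α τ * (Real.exp (-(c * τ)) : ℂ) = mlG α c := by
  have hc0 : 0 < c := by linarith
  have h := mlg_laplace_real α h0 h1 c hc
  have h' := ml_geom (α : ℂ) (1 - α) (((1 / c) ^ (2 - α) : ℝ) : ℂ)
    (Complex.I * ((1 / c) ^ α : ℝ)) (by
      rw [norm_mul, Complex.norm_I, one_mul, Complex.norm_real, Real.norm_of_nonneg (by positivity)]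
      exact ml_qlt α h0 c hc)
  rw [h.unique h']
  unfold mlG
  rw [← Complex.ofReal_cpow hc0.le, ← Complex.ofReal_cpow hc0.le]
  have e1 : (1 / c) ^ (2 - α) = c ^ α * c ^ (-2 : ℝ) := by
    rw [one_div, Real.inv_rpow hc0.le, ← Real.rpow_neg hc0.le, ← Real.rpow_add hc0]; ring_nf
  have e2 : c ^ (2 * α - 2) = c ^ α * c ^ α * c ^ (-2 : ℝ) := by
    rw [← Real.rpow_add hc0, ← Real.rpow_add hc0]; ring_nf
  have e3 : (1 / c) ^ α = (c ^ α)⁻¹ := by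
    rw [one_div, Real.inv_rpow hc0.le]
  rw [e1, e2, e3]
  have hp : 0 < c ^ α := by positivity
  generalize c ^ α = p at hp
  generalize c ^ (-2 : ℝ) = d
  have hpc : (p : ℂ) ≠ 0 := by exact_mod_cast hp.ne'
  have hpi : (p : ℂ) - Complex.I ≠ 0 := by
    intro h
    have := congrArg Complex.im h
    simp at this
  have h1q : (1 : ℂ) - Complex.I * ((p⁻¹ : ℝ) : ℂ) = (p - Complex.I) / p := by
    push_cast; field_simp
  rw [h1q]
  push_cast
  field_simp
  ring

lemma ml_denom_bound (α : ℝ) (h0 : 0 < α) (h1 : α < 1) (s : ℂ) (hs : 0 ≤ s.re) :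
    Real.cos (α * (π / 2)) / 4 * (1 + ‖s‖ ^ α) ≤ ‖s ^ (α : ℂ) - Complex.I‖ := by
  set κ := Real.cos (α * (π / 2)) with hκ
  have hκ1 : κ ≤ 1 := Real.cos_le_one _
  have hκ0 : 0 < κ := by
    apply Real.cos_pos_of_mem_Ioo
    constructor <;> nlinarith [Real.pi_pos]
  have harg : |s.arg| ≤ π / 2 := Complex.abs_arg_le_pi_div_two_iff.2 hs
  have hre : κ * ‖s‖ ^ α ≤ ‖s ^ (α : ℂ) - Complex.I‖ := by
    calc κ * ‖s‖ ^ α ≤ ‖s‖ ^ α * Real.cos (s.arg * α) := by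
          rw [mul_comm]
          gcongr
          rw [hκ, ← Real.cos_abs (s.arg * α), abs_mul, abs_of_pos h0, mul_comm]
          apply Real.cos_le_cos_of_nonneg_of_le_pi
          · positivity
          · nlinarith [Real.pi_pos]
          · nlinarith
      _ = (s ^ (α : ℂ) - Complex.I).re := by
          rw [Complex.sub_re, Complex.cpow_ofReal_re]; simp
      _ ≤ _ := Complex.re_le_norm _
  have hn : 1 - ‖s‖ ^ α ≤ ‖s ^ (α : ℂ) - Complex.I‖ := by
    have := norm_sub_norm_le Complex.I (s ^ (α : ℂ))
    rwa [Complex.norm_I, Complex.norm_cpow_real, norm_sub_rev] at this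
  have hp : 0 ≤ ‖s‖ ^ α := by positivity
  rcases le_total (‖s‖ ^ α) (1 / 2) with h | h <;> nlinarith

/-- Constant in the bound. -/
noncomputable def mlC (α : ℝ) : ℝ :=
  (Real.cos (α * (π / 2)) / 4)⁻¹ + ((Real.cos (α * (π / 2)) / 4)⁻¹) ^ 2

/-- Integrable majorant. -/
noncomputable def mlB (α : ℝ) (y : ℝ) : ℝ := mlC α * (|y| ^ (2 * α - 2) / (1 + |y| ^ α))

lemma ml_kappa_pos (α : ℝ) (h0 : 0 < α) (h1 : α < 1) : 0 < Real.cos (α * (π / 2)) / 4 := by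
  have : 0 < Real.cos (α * (π / 2)) := by
    apply Real.cos_pos_of_mem_Ioo
    constructor <;> nlinarith [Real.pi_pos]
  positivity

lemma mlG_bound (α : ℝ) (h0 : 0 < α) (h1 : α < 1) (s : ℂ) (hs : 0 ≤ s.re) (hi : s.im ≠ 0) :
    ‖mlG α s‖ ≤ mlB α s.im := by
  have hδ := ml_kappa_pos α h0 h1
  have hb := ml_denom_bound α h0 h1 s hs
  have hy : 0 < |s.im| := abs_pos.2 hi
  have hle : |s.im| ≤ ‖s‖ := Complex.abs_im_le_norm s
  unfold mlB mlC
  set δ := Real.cos (α * (π / 2)) / 4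
  have hD : δ * (1 + |s.im| ^ α) ≤ ‖s ^ (α : ℂ) - Complex.I‖ := by
    refine le_trans ?_ hb
    gcongr
  set D := ‖s ^ (α : ℂ) - Complex.I‖ with hDdef
  have hp : 0 < |s.im| ^ α := by positivity
  have hP : (1:ℝ) ≤ 1 + |s.im| ^ α := by linarith
  set P := 1 + |s.im| ^ α with hPdef
  have hDpos : 0 < D := lt_of_lt_of_le (by positivity) hD
  have h2 : ‖s ^ ((2 * α - 2 : ℝ) : ℂ)‖ ≤ |s.im| ^ (2 * α - 2) := by
    rw [Complex.norm_cpow_real]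
    exact Real.rpow_le_rpow_of_nonpos hy hle (by linarith)
  have hα1 : ‖(1 - α : ℂ)‖ ≤ 1 := by
    rw [show (1 - α : ℂ) = ((1 - α : ℝ) : ℂ) by push_cast; ring, Complex.norm_real,
      Real.norm_of_nonneg (by linarith)]
    linarith
  have hα2 : ‖(α * Complex.I : ℂ)‖ ≤ 1 := by
    rw [norm_mul, Complex.norm_I, Complex.norm_real, Real.norm_of_nonneg h0.le]
    linarith
  have h3 : ‖((1 - α) / (s ^ (α : ℂ) - Complex.I) +
    α * Complex.I / (s ^ (α : ℂ) - Complex.I) ^ 2 : ℂ)‖ ≤ (δ⁻¹ + δ⁻¹ ^ 2) / P := by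
    refine (norm_add_le _ _).trans ?_
    rw [norm_div, norm_div, norm_pow, ← hDdef]
    calc _ ≤ 1 / (δ * P) + 1 / (δ * P) ^ 2 := by gcongr
      _ ≤ 1 / (δ * P) + 1 / (δ ^ 2 * P) := by
          gcongr
          rw [mul_pow]
          gcongr
          nlinarith
      _ = _ := by field_simp
  unfold mlG
  rw [norm_mul]
  calc _ ≤ |s.im| ^ (2 * α - 2) * ((δ⁻¹ + δ⁻¹ ^ 2) / P) := by gcongr
    _ = _ := by ring

lemma mlG_differentiableAt (α : ℝ) (h0 : 0 < α) (h1 : α < 1) (s : ℂ) (hs : 0 ≤ s.re)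
    (hs0 : s ≠ 0) : DifferentiableAt ℂ (mlG α) s := by
  have hsl : s ∈ Complex.slitPlane := by
    rw [Complex.mem_slitPlane_iff]
    by_cases h : s.im = 0
    · left
      refine lt_of_le_of_ne hs (fun h' => hs0 (Complex.ext h'.symm h))
    · right; exact h
  have hne : s ^ (α : ℂ) - Complex.I ≠ 0 := by
    rw [← norm_pos_iff]
    have := ml_kappa_pos α h0 h1
    exact lt_of_lt_of_le (by positivity) (ml_denom_bound α h0 h1 s hs)
  have hc : ∀ a : ℂ, DifferentiableAt ℂ (fun s : ℂ => s ^ a) s := fun a =>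
    (differentiableAt_id).cpow_const hsl
  unfold mlG
  have hsub := (hc α).sub_const Complex.I
  exact (hc _).mul (((differentiableAt_const _).div hsub hne).add
    ((differentiableAt_const _).div (hsub.pow 2) (pow_ne_zero 2 hne)))

lemma mlB_integrable (α : ℝ) (h0 : 1 / 2 < α) (h1 : α < 1) : Integrable (mlB α) := by
  unfold mlB
  refine Integrable.const_mul ?_ _
  set f : ℝ → ℝ := fun y => |y| ^ (2 * α - 2) / (1 + |y| ^ α) with hf
  have hmeas : Measurable f := by fun_prop
  have hI : IntegrableOn f (Ioi 0) := by
    rw [← Ioc_union_Ioi_eq_Ioi (zero_le_one (α := ℝ))]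
    apply IntegrableOn.union
    · have := (intervalIntegral.intervalIntegrable_rpow' (a := 0) (b := 1)
        (r := 2 * α - 2) (by linarith)).1
      refine Integrable.mono' this hmeas.aestronglyMeasurable ?_
      filter_upwards [ae_restrict_mem measurableSet_Ioc] with y hy
      have hy0 : 0 < y := hy.1
      rw [hf, Real.norm_of_nonneg (by positivity)]
      simp only [abs_of_pos hy0]
      apply div_le_self (by positivity)
      have : 0 < y ^ α := by positivity
      linarith
    · have := integrableOn_Ioi_rpow_of_lt (a := α - 2) (c := 1) (by linarith) one_pos
      refine Integrable.mono' this hmeas.aestronglyMeasurable ?_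
      filter_upwards [ae_restrict_mem measurableSet_Ioi] with y hy
      have hy0 : 0 < y := lt_trans one_pos hy
      rw [hf, Real.norm_of_nonneg (by positivity)]
      simp only [abs_of_pos hy0]
      have : 0 < y ^ α := by positivity
      rw [div_le_iff₀ (by positivity), show 2 * α - 2 = (α - 2) + α by ring, Real.rpow_add hy0]
      gcongr
      linarith
  have heven : ∀ y, f (-y) = f y := fun y => by simp [hf]
  have hI2 : IntegrableOn f (Iio 0) := by
    have h3 : IntegrableOn f (Ioi (-0)) := by simpa using hI
    have := h3.comp_neg_Iio
    simpa [heven] using this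
  rw [← integrableOn_univ, ← Iic_union_Ioi (a := (0:ℝ))]
  exact ((integrableOn_Iic_iff_integrableOn_Iio (by simp)).2 hI2).union hI

lemma mlB_tendsto (α : ℝ) (h0 : 0 < α) (h1 : α < 1) : Tendsto (mlB α) atTop (𝓝 0) := by
  have hC : 0 ≤ mlC α := by
    have := ml_kappa_pos α h0 h1
    unfold mlC; positivity
  have h := (tendsto_rpow_neg_atTop (y := 2 - 2 * α) (by linarith)).const_mul (mlC α)
  rw [mul_zero] at h
  refine squeeze_zero' (Eventually.of_forall fun y => by unfold mlB; positivity) ?_ h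
  filter_upwards [eventually_gt_atTop 0] with y hy
  unfold mlB
  gcongr
  rw [abs_of_pos hy, show -(2 - 2 * α) = 2 * α - 2 by ring]
  apply div_le_self (by positivity)
  have : 0 < y ^ α := by positivity
  linarith

lemma mlL_differentiable (α : ℝ) (h0 : 0 < α) (h1 : α < 1) :
    DifferentiableOn ℂ (fun s : ℂ => ∫ τ in Ioi (0:ℝ), mlg α τ * Complex.exp (-(s * τ)))
      {s | 1 < s.re} := by
  intro s hs
  have hs : 1 < s.re := hs
  apply DifferentiableAt.differentiableWithinAt
  set ε := (s.re - 1) / 3 with hε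
  have hε0 : 0 < ε := by rw [hε]; linarith
  have hcm := mlg_continuousOn α h0
  refine (hasDerivAt_integral_of_dominated_loc_of_deriv_le (s := Metric.ball s ε)
    (F' := fun (z : ℂ) (τ : ℝ) => mlg α τ * (Complex.exp (-(z * τ)) * (-τ)))
    (bound := fun τ => ε⁻¹ * ‖mlg α τ * (Real.exp (-((1 + ε) * τ)) : ℂ)‖)
    (Metric.ball_mem_nhds s hε0) ?_ ?_ ?_ ?_ ?_ ?_).2.differentiableAt
  · refine Eventually.of_forall fun z => ?_
    have hc2 : ContinuousOn (fun τ : ℝ => Complex.exp (-(z * τ))) (Ioi 0) := by fun_prop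
    exact (hcm.mul hc2).aestronglyMeasurable measurableSet_Ioi
  · have hc2 : ContinuousOn (fun τ : ℝ => Complex.exp (-(s * τ))) (Ioi 0) := by fun_prop
    refine Integrable.mono (mlg_integrable α h0 h1 s.re hs)
      ((hcm.mul hc2).aestronglyMeasurable measurableSet_Ioi) ?_
    refine Eventually.of_forall fun τ => ?_
    rw [norm_mul, norm_mul, Complex.norm_exp, Complex.norm_real,
      Real.norm_of_nonneg (Real.exp_pos _).le]
    simp
  · have hc2 : ContinuousOn (fun τ : ℝ => Complex.exp (-(s * τ)) * (-τ : ℂ)) (Ioi 0) := by fun_prop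
    exact (hcm.mul hc2).aestronglyMeasurable measurableSet_Ioi
  · filter_upwards [ae_restrict_mem measurableSet_Ioi] with τ hτ z hz
    have hτ : 0 < τ := hτ
    have hzr : 1 + 2 * ε ≤ z.re := by
      have h1 : ‖z - s‖ < ε := by simpa [dist_eq_norm] using hz
      have h2 := (abs_le.1 ((Complex.abs_re_le_norm (z - s)).trans h1.le)).1
      rw [Complex.sub_re] at h2
      have : s.re = 1 + 3 * ε := by rw [hε]; ring
      linarith
    rw [norm_mul, norm_mul, norm_mul, Complex.norm_exp, Complex.norm_real,
      Real.norm_of_nonneg (Real.exp_pos _).le, norm_neg, Complex.norm_real,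
      Real.norm_of_nonneg hτ.le]
    have hre : (-(z * τ) : ℂ).re = -(z.re * τ) := by simp
    rw [hre]
    have h3 : τ ≤ ε⁻¹ * Real.exp (ε * τ) := by
      have := Real.add_one_le_exp (ε * τ)
      rw [inv_mul_eq_div, le_div_iff₀ hε0]
      linarith
    have h4 : Real.exp (-(z.re * τ)) ≤ Real.exp (-((1 + 2 * ε) * τ)) := by
      gcongr
    calc ‖mlg α τ‖ * (Real.exp (-(z.re * τ)) * τ)
        ≤ ‖mlg α τ‖ * (Real.exp (-((1 + 2 * ε) * τ)) * (ε⁻¹ * Real.exp (ε * τ))) := by gcongr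
      _ = ε⁻¹ * (‖mlg α τ‖ * (Real.exp (-((1 + 2 * ε) * τ)) * Real.exp (ε * τ))) := by ring
      _ = _ := by rw [← Real.exp_add]; ring_nf
  · exact (mlg_integrable α h0 h1 (1 + ε) (by linarith)).norm.const_mul _
  · refine Eventually.of_forall fun τ z _ => ?_
    have : HasDerivAt (fun z : ℂ => -(z * τ)) (-τ : ℂ) z := by
      have h := (hasDerivAt_id z).mul_const (-τ : ℂ)
      simp only [id, one_mul, mul_neg] at h
      exact h
    exact this.cexp.const_mul _

lemma mlL_eq (α : ℝ) (h0 : 0 < α) (h1 : α < 1) (s : ℂ) (hs : 1 < s.re) :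
    ∫ τ in Ioi (0:ℝ), mlg α τ * Complex.exp (-(s * τ)) = mlG α s := by
  have ho : IsOpen {s : ℂ | 1 < s.re} := isOpen_lt continuous_const Complex.continuous_re
  have hG : DifferentiableOn ℂ (mlG α) {s | 1 < s.re} := fun z hz => by
    have hz : 1 < z.re := hz
    refine (mlG_differentiableAt α h0 h1 z (by linarith) ?_).differentiableWithinAt
    rintro rfl
    simp at hz
    linarith
  have hA := (mlL_differentiable α h0 h1).analyticOnNhd ho
  have hB := hG.analyticOnNhd ho
  refine hA.eqOn_of_preconnected_of_frequently_eq hB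
    ((convex_halfSpace_re_gt 1).isPreconnected) (z₀ := ((2:ℝ):ℂ)) (by simp) ?_ hs
  rw [frequently_nhdsWithin_iff]
  have hc : Tendsto (fun y : ℝ => (y : ℂ)) (𝓝 2) (𝓝 ((2:ℝ) : ℂ)) :=
    Complex.continuous_ofReal.tendsto 2
  refine hc.frequently ?_
  have hf : ∃ᶠ y in 𝓝[>] (2:ℝ), y ∈ Ioi (2:ℝ) :=
    Eventually.frequently self_mem_nhdsWithin
  refine (hf.filter_mono nhdsWithin_le_nhds).mono ?_
  intro y hy
  have hy : 2 < y := hy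
  refine ⟨?_, ?_⟩
  · rw [← mlG_real α h0 h1 y (by linarith)]
    push_cast; rfl
  · simp only [mem_compl_iff, mem_singleton_iff, Complex.ofReal_inj]; exact hy.ne'

lemma mlB_nonneg (α : ℝ) (h0 : 0 < α) (h1 : α < 1) (y : ℝ) : 0 ≤ mlB α y := by
  have := ml_kappa_pos α h0 h1
  unfold mlB mlC; positivity

lemma mlG_line_continuousOn (α : ℝ) (h0 : 0 < α) (h1 : α < 1) (x : ℝ) (hx : 0 ≤ x) :
    ContinuousOn (fun y : ℝ => mlG α (x + y * Complex.I)) {0}ᶜ := by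
  intro y hy
  apply ContinuousAt.continuousWithinAt
  have hd : ContinuousAt (mlG α) (x + y * Complex.I) := by
    refine (mlG_differentiableAt α h0 h1 _ (by simpa using hx) ?_).continuousAt
    intro h
    have := congrArg Complex.im h
    simp at this
    exact hy this
  exact ContinuousAt.comp (f := fun y : ℝ => (x + y * Complex.I : ℂ)) hd (by fun_prop)

lemma mlG_line_meas (α : ℝ) (h0 : 0 < α) (h1 : α < 1) (x : ℝ) (hx : 0 ≤ x) :
    AEStronglyMeasurable (fun y : ℝ => mlG α (x + y * Complex.I)) volume := by
  have h := (mlG_line_continuousOn α h0 h1 x hx).aestronglyMeasurable (μ := volume)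
    (measurableSet_singleton 0).compl
  rwa [restrict_compl_singleton] at h

lemma ml_ae_ne : ∀ᵐ y : ℝ, y ≠ 0 := by
  simp [ae_iff]

lemma mlG_line_bound (α : ℝ) (h0 : 0 < α) (h1 : α < 1) (x : ℝ) (hx : 0 ≤ x) (y : ℝ)
    (hy : y ≠ 0) : ‖mlG α (x + y * Complex.I)‖ ≤ mlB α y := by
  have := mlG_bound α h0 h1 (x + y * Complex.I) (by simpa using hx) (by simpa using hy)
  simpa using this

lemma mlG_line_integrable (α : ℝ) (h0 : 1 / 2 < α) (h1 : α < 1) (x : ℝ) (hx : 0 ≤ x) :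
    Integrable (fun y : ℝ => mlG α (x + y * Complex.I)) := by
  refine (mlB_integrable α h0 h1).mono' (mlG_line_meas α (by linarith) h1 x hx) ?_
  filter_upwards [ml_ae_ne] with y hy
  exact mlG_line_bound α (by linarith) h1 x hx y hy

/-- Inversion integrand. -/
noncomputable def mlF (α τ : ℝ) (s : ℂ) : ℂ := Complex.exp (s * τ) * mlG α s

lemma ml_exp_norm (x y τ : ℝ) : ‖Complex.exp ((x + y * Complex.I) * τ)‖ = Real.exp (x * τ) := by
  rw [Complex.norm_exp]; simp

lemma mlF_line_bound (α : ℝ) (h0 : 0 < α) (h1 : α < 1) (τ : ℝ) (hτ : 0 < τ) (x : ℝ) (hx : 0 ≤ x)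
    (hx2 : x ≤ 2) (y : ℝ) (hy : y ≠ 0) :
    ‖mlF α τ (x + y * Complex.I)‖ ≤ Real.exp (2 * τ) * mlB α y := by
  unfold mlF
  rw [norm_mul, ml_exp_norm]
  have := mlG_line_bound α h0 h1 x hx y hy
  gcongr

lemma mlF_line_meas (α : ℝ) (h0 : 0 < α) (h1 : α < 1) (τ : ℝ) (x : ℝ) (hx : 0 ≤ x) :
    AEStronglyMeasurable (fun y : ℝ => mlF α τ (x + y * Complex.I)) volume := by
  unfold mlF
  have hc : Continuous (fun y : ℝ => Complex.exp ((x + y * Complex.I) * τ)) := by fun_prop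
  exact hc.aestronglyMeasurable.mul (mlG_line_meas α h0 h1 x hx)

lemma mlF_line_integrable (α : ℝ) (h0 : 1 / 2 < α) (h1 : α < 1) (τ : ℝ) (hτ : 0 < τ)
    (x : ℝ) (hx : 0 ≤ x) (hx2 : x ≤ 2) :
    Integrable (fun y : ℝ => mlF α τ (x + y * Complex.I)) := by
  refine ((mlB_integrable α h0 h1).const_mul (Real.exp (2 * τ))).mono'
    (mlF_line_meas α (by linarith) h1 τ x hx) ?_
  filter_upwards [ml_ae_ne] with y hy
  exact mlF_line_bound α (by linarith) h1 τ hτ x hx hx2 y hy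

lemma mlF_differentiableAt (α : ℝ) (h0 : 0 < α) (h1 : α < 1) (τ : ℝ) (s : ℂ) (hs : 0 ≤ s.re)
    (hs0 : s ≠ 0) : DifferentiableAt ℂ (mlF α τ) s := by
  unfold mlF
  have hc : DifferentiableAt ℂ (fun s : ℂ => Complex.exp (s * τ)) s := by fun_prop
  exact hc.mul (mlG_differentiableAt α h0 h1 s hs hs0)

lemma mlF_shift (α : ℝ) (h0 : 1 / 2 < α) (h1 : α < 1) (τ : ℝ) (hτ : 0 < τ)
    (x : ℝ) (hx : 0 < x) (hx2 : x ≤ 2) :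
    ∫ y : ℝ, mlF α τ (x + y * Complex.I) = ∫ y : ℝ, mlF α τ ((2:ℝ) + y * Complex.I) := by
  have h0' : 0 < α := by linarith
  have hlim : ∀ c : ℝ, 0 ≤ c → c ≤ 2 → Tendsto
      (fun T : ℝ => ∫ y in (-T)..T, mlF α τ (c + y * Complex.I)) atTop
      (𝓝 (∫ y : ℝ, mlF α τ (c + y * Complex.I))) := fun c hc hc2 =>
    intervalIntegral_tendsto_integral (mlF_line_integrable α h0 h1 τ hτ c hc hc2)
      tendsto_neg_atTop_atBot tendsto_id
  have hB0 : Tendsto (fun T : ℝ => Real.exp (2 * τ) * mlB α T * |2 - x|) atTop (𝓝 0) := by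
    have := ((mlB_tendsto α h0' h1).const_mul (Real.exp (2 * τ))).mul_const |2 - x|
    simpa using this
  have heven : ∀ T, mlB α (-T) = mlB α T := fun T => by unfold mlB; simp
  have hside : ∀ T : ℝ, T ≠ 0 → ‖∫ u in x..2, mlF α τ (u + (T : ℂ) * Complex.I)‖ ≤
      Real.exp (2 * τ) * mlB α T * |2 - x| := by
    intro T hT
    apply intervalIntegral.norm_integral_le_of_norm_le_const
    intro u hu
    rw [uIoc_of_le hx2] at hu
    exact mlF_line_bound α h0' h1 τ hτ u (by linarith [hu.1]) hu.2 T hT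
  have htop : Tendsto (fun T : ℝ => ∫ u in x..2, mlF α τ (u + (T : ℂ) * Complex.I)) atTop (𝓝 0) := by
    refine squeeze_zero_norm' ?_ hB0
    filter_upwards [eventually_gt_atTop 0] with T hT
    exact hside T hT.ne'
  have hbot : Tendsto (fun T : ℝ => ∫ u in x..2, mlF α τ (u + ((-T : ℝ) : ℂ) * Complex.I))
      atTop (𝓝 0) := by
    refine squeeze_zero_norm' ?_ hB0
    filter_upwards [eventually_gt_atTop 0] with T hT
    have := hside (-T) (neg_ne_zero.2 hT.ne')
    rwa [heven] at this
  have hrect : ∀ T : ℝ, ((∫ u in x..2, mlF α τ (u + ((-T : ℝ) : ℂ) * Complex.I)) -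
      (∫ u in x..2, mlF α τ (u + (T : ℂ) * Complex.I)) +
      Complex.I • ∫ y in (-T)..T, mlF α τ ((2:ℝ) + y * Complex.I)) -
      Complex.I • ∫ y in (-T)..T, mlF α τ (x + y * Complex.I) = 0 := by
    intro T
    have := Complex.integral_boundary_rect_eq_zero_of_differentiableOn (mlF α τ)
      ⟨x, -T⟩ ⟨2, T⟩ (by
        intro s hs
        have hsre : s.re ∈ uIcc x 2 := hs.1
        rw [uIcc_of_le hx2] at hsre
        have hpos : 0 < s.re := lt_of_lt_of_le hx hsre.1
        refine (mlF_differentiableAt α h0' h1 τ s hpos.le ?_).differentiableWithinAt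
        rintro rfl
        simp at hpos)
    exact this
  have hl := ((hbot.sub htop).add ((hlim 2 (by norm_num) le_rfl).const_smul Complex.I)).sub
    ((hlim x hx.le hx2).const_smul Complex.I)
  simp_rw [hrect] at hl
  have hz := tendsto_nhds_unique hl tendsto_const_nhds
  simp only [sub_zero, zero_add, smul_eq_mul, ← mul_sub] at hz
  have := (mul_eq_zero.1 hz).resolve_left Complex.I_ne_zero
  exact (sub_eq_zero.1 this).symm

lemma mlF_shift0 (α : ℝ) (h0 : 1 / 2 < α) (h1 : α < 1) (τ : ℝ) (hτ : 0 < τ) :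
    ∫ y : ℝ, mlF α τ ((0:ℝ) + y * Complex.I) = ∫ y : ℝ, mlF α τ ((2:ℝ) + y * Complex.I) := by
  have h0' : 0 < α := by linarith
  have hmem : ∀ᶠ x : ℝ in 𝓝[>] 0, 0 < x ∧ x ≤ 2 := by
    filter_upwards [Ioc_mem_nhdsGT (show (0:ℝ) < 2 by norm_num)] with x hx
    exact hx
  have hT : Tendsto (fun x : ℝ => ∫ y : ℝ, mlF α τ (x + y * Complex.I)) (𝓝[>] 0)
      (𝓝 (∫ y : ℝ, mlF α τ ((0:ℝ) + y * Complex.I))) := by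
    refine tendsto_integral_filter_of_dominated_convergence
      (fun y => Real.exp (2 * τ) * mlB α y) ?_ ?_ ?_ ?_
    · filter_upwards [hmem] with x hx
      exact mlF_line_meas α h0' h1 τ x hx.1.le
    · filter_upwards [hmem] with x hx
      filter_upwards [ml_ae_ne] with y hy
      exact mlF_line_bound α h0' h1 τ hτ x hx.1.le hx.2 y hy
    · exact (mlB_integrable α h0 h1).const_mul _
    · filter_upwards [ml_ae_ne] with y hy
      have hd : ContinuousAt (mlF α τ) ((0:ℝ) + y * Complex.I) := by
        refine (mlF_differentiableAt α h0' h1 τ _ (by simp) ?_).continuousAt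
        simpa using hy
      have := ContinuousAt.comp (x := (0:ℝ)) (f := fun x : ℝ => (x + y * Complex.I : ℂ)) hd
        (by fun_prop)
      exact this.tendsto.mono_left nhdsWithin_le_nhds
  refine tendsto_nhds_unique hT (tendsto_const_nhds.congr' ?_)
  filter_upwards [hmem] with x hx
  exact (mlF_shift α h0 h1 τ hτ x hx.1 hx.2).symm

lemma mlg_inversion (α : ℝ) (h0 : 1 / 2 < α) (h1 : α < 1) (τ : ℝ) (hτ : 0 < τ) :
    mlg α τ = ∫ w : ℝ, mlF α τ ((2:ℝ) + ((2 * π * w : ℝ) : ℂ) * Complex.I) := by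
  have h0' : 0 < α := by linarith
  set f : ℝ → ℂ := (Ioi (0:ℝ)).indicator (fun v => mlg α v * (Real.exp (-(2 * v)) : ℂ)) with hf
  have hfi : Integrable f :=
    (integrable_indicator_iff measurableSet_Ioi).2 (mlg_integrable α h0' h1 2 (by norm_num))
  have hF : FourierTransform.fourier f =
      fun w : ℝ => mlG α ((2:ℝ) + ((2 * π * w : ℝ) : ℂ) * Complex.I) := by
    ext w
    rw [Real.fourier_real_eq_integral_exp_smul, ← mlL_eq α h0' h1 _ (by simp),
      ← integral_indicator measurableSet_Ioi]
    congr 1; ext v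
    by_cases hv : v ∈ Ioi (0:ℝ)
    · rw [hf, indicator_of_mem hv, indicator_of_mem hv, smul_eq_mul, Complex.ofReal_exp,
        mul_left_comm, ← Complex.exp_add]
      congr 2
      push_cast; ring
    · rw [hf, indicator_of_notMem hv, indicator_of_notMem hv, smul_zero]
  have hFi : Integrable (FourierTransform.fourier f) := by
    rw [hF]
    exact (mlG_line_integrable α h0 h1 2 (by norm_num)).comp_mul_left' (R := 2 * π) (by positivity)
  have hfc : ContinuousAt f τ := by
    have hc : ContinuousAt (fun v : ℝ => mlg α v * (Real.exp (-(2 * v)) : ℂ)) τ := by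
      have := (mlg_continuousOn α h0').continuousAt (Ioi_mem_nhds hτ)
      exact this.mul (by fun_prop)
    refine hc.congr ?_
    filter_upwards [Ioi_mem_nhds hτ] with v hv
    rw [hf, indicator_of_mem hv]
  have hinv := hfi.fourierInv_fourier_eq hFi hfc
  rw [Real.fourierInv_eq', hF, hf, indicator_of_mem (show τ ∈ Ioi (0:ℝ) from hτ)] at hinv
  have hne : (Real.exp (-(2 * τ)) : ℂ) ≠ 0 := by exact_mod_cast (Real.exp_pos _).ne'
  apply mul_right_cancel₀ hne
  rw [← hinv, ← integral_mul_const]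
  congr 1; ext w
  unfold mlF
  rw [smul_eq_mul, mul_right_comm (Complex.exp _) (mlG _ _) _, Complex.ofReal_exp, ← Complex.exp_add]
  congr 2
  simp
  ring

lemma mlg_eq_fourier (α : ℝ) (h0 : 1 / 2 < α) (h1 : α < 1) (τ : ℝ) (hτ : 0 < τ) :
    mlg α τ = FourierTransform.fourier
      (fun w : ℝ => mlG α (((2 * π * w : ℝ) : ℂ) * Complex.I)) (-τ) := by
  rw [mlg_inversion α h0 h1 τ hτ, Real.fourier_real_eq_integral_exp_smul]
  have e1 := Measure.integral_comp_mul_left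
    (fun y : ℝ => mlF α τ ((2:ℝ) + (y : ℂ) * Complex.I)) (2 * π)
  have e2 := Measure.integral_comp_mul_left
    (fun y : ℝ => mlF α τ ((0:ℝ) + (y : ℂ) * Complex.I)) (2 * π)
  rw [e1, ← mlF_shift0 α h0 h1 τ hτ, ← e2]
  congr 1; ext w
  unfold mlF
  simp
  left
  congr 1
  ring

lemma mlg_tendsto (α : ℝ) (h0 : 1 / 2 < α) (h1 : α < 1) : Tendsto (mlg α) atTop (𝓝 0) := by
  have h := Real.zero_at_infty_fourier
    (fun w : ℝ => mlG α (((2 * π * w : ℝ) : ℂ) * Complex.I))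
  have h2 : Tendsto (fun τ : ℝ => -τ) atTop (cocompact ℝ) :=
    tendsto_neg_atTop_atBot.mono_right atBot_le_cocompact
  refine (h.comp h2).congr' ?_
  filter_upwards [eventually_gt_atTop 0] with τ hτ
  exact (mlg_eq_fourier α h0 h1 τ hτ).symm

lemma ml_large (α : ℝ) (h0 : 1 / 2 < α) (h1 : α < 1) :
    ∃ R : ℝ, 0 < R ∧ ∀ t : ℝ, R ≤ t → mlE α 1 (Complex.I * t) ≠ 0 := by
  have h0' : 0 < α := by linarith
  have hG : 0 < Real.Gamma (1 - α) := Real.Gamma_pos_of_pos (by linarith)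
  have ha : ∀ᶠ τ in atTop, ‖mlg α τ‖ < 1 := by
    have := (mlg_tendsto α h0 h1).norm
    rw [norm_zero] at this
    exact this.eventually_lt_const one_pos
  have hb : ∀ᶠ τ : ℝ in atTop, Real.Gamma (1 - α) ≤ τ ^ (1 - α) :=
    (tendsto_rpow_atTop (by linarith)).eventually_ge_atTop _
  have hc : ∀ᶠ τ : ℝ in atTop, mlE α 1 (Complex.I * ((τ ^ α : ℝ) : ℂ)) ≠ 0 := by
    filter_upwards [ha, hb] with τ h1 h2 h3
    unfold mlg at h1
    rw [h3, mul_zero, add_zero, Complex.norm_real] at h1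
    have h4 : 1 ≤ τ ^ (1 - α) / Real.Gamma (1 - α) := by rwa [one_le_div hG]
    linarith [Real.le_norm_self (τ ^ (1 - α) / Real.Gamma (1 - α))]
  have hd : ∀ᶠ t : ℝ in atTop, mlE α 1 (Complex.I * t) ≠ 0 := by
    filter_upwards [(tendsto_rpow_atTop (y := 1 / α) (by positivity)).eventually hc,
      eventually_gt_atTop 0] with t ht ht0
    rwa [← Real.rpow_mul ht0.le, one_div_mul_cancel h0'.ne', Real.rpow_one] at ht
  obtain ⟨R, hR⟩ := eventually_atTop.1 hd
  exact ⟨max R 1, by positivity, fun t ht => hR t ((le_max_left _ _).trans ht)⟩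

theorem mittagLeffler_finitely_many_imaginary_zeros (α : ℝ) (hα0 : 3 / 5 < α)
    (hα1 : α < 1) :
    (∃ R : ℝ, 0 < R ∧ ∀ t : ℝ, R ≤ |t| → mlE α 1 (Complex.I * t) ≠ 0) ∧
    {t : ℝ | mlE α 1 (Complex.I * t) = 0}.Finite := by
  obtain ⟨R, hR0, hR⟩ := ml_large α (by linarith) hα1
  have hmain : ∀ t : ℝ, R ≤ |t| → mlE α 1 (Complex.I * t) ≠ 0 := by
    intro t ht
    rcases abs_cases t with ⟨h, -⟩ | ⟨h, -⟩
    · exact hR t (h ▸ ht)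
    · intro h0
      apply hR (-t) (h ▸ ht)
      have := ml_conj α (Complex.I * t)
      rw [h0, map_zero] at this
      rw [← this]
      congr 1
      simp
  exact ⟨⟨R, hR0, hmain⟩, ml_finite α (by linarith) R hmain⟩
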